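/- Let U ⊆ ℋ be a closed subspace with orthogonal projection P_U, assume T_n = P_U T_n P_U for all n ≥ 1, and assume the exhaustion condition: for every x ∈ U, ⟨x, R_n x⟩ → 0 as n → ∞. Then the strong limit R_∞ of the shorting iterates equals the orthogonal projection P_{U^⊥} onto the orthogonal complement of U. -/

import Mathlib

set_option synthInstance.maxHeartbeats 1000000
set_option maxHeartbeats 1000000

open Filter Topology ContinuousLinearMap
open scoped ComplexOrder

/-- The shorting iterates: `R 0 = I` and `R (n+1) = R n ^ (1/2) * (I - T (n+1)) * R n ^ (1/2)`,
where `CFC.sqrt` is the positive square root (from the continuous functional calculus). -/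
noncomputable def shortR {ℋ : Type*} [NormedAddCommGroup ℋ] [InnerProductSpace ℂ ℋ]
    [CompleteSpace ℋ] (T : ℕ → ℋ →L[ℂ] ℋ) : ℕ → ℋ →L[ℂ] ℋ
  | 0 => 1
  | n + 1 => CFC.sqrt (shortR T n) * (1 - T (n + 1)) * CFC.sqrt (shortR T n)

/-- The orthogonal projection of `ℋ` onto a (closed) subspace `U`, as an operator `ℋ →L[ℂ] ℋ`. -/
noncomputable def projCLM {ℋ : Type*} [NormedAddCommGroup ℋ] [InnerProductSpace ℂ ℋ]
    (U : Submodule ℂ ℋ) [Submodule.HasOrthogonalProjection U] : ℋ →L[ℂ] ℋ :=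
  U.subtypeL ∘L Submodule.orthogonalProjectionOnto U

theorem aux_sqrt_fix {ℋ : Type*} [NormedAddCommGroup ℋ] [InnerProductSpace ℂ ℋ]
    [CompleteSpace ℋ] (R : ℋ →L[ℂ] ℋ) (hR : 0 ≤ R) (x : ℋ) (hx : R x = x) :
    CFC.sqrt R x = x := by
  have hS : (CFC.sqrt R).IsPositive := (nonneg_iff_isPositive _).1 (CFC.sqrt_nonneg R)
  have hSS : CFC.sqrt R (CFC.sqrt R x) = x := by
    have := congrArg (fun A : ℋ →L[ℂ] ℋ => A x) (CFC.sqrt_mul_sqrt_self R hR)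
    simpa [hx] using this
  have hy : CFC.sqrt R (CFC.sqrt R x - x) = -(CFC.sqrt R x - x) := by
    rw [map_sub, hSS]; abel
  have h0 := hS.re_inner_nonneg_left (CFC.sqrt R x - x)
  rw [hy, inner_neg_left, map_neg, inner_self_eq_norm_sq] at h0
  have h1 : ‖CFC.sqrt R x - x‖ = 0 := by nlinarith [norm_nonneg (CFC.sqrt R x - x)]
  exact sub_eq_zero.1 (norm_eq_zero.1 h1)

theorem aux_zero {ℋ : Type*} [NormedAddCommGroup ℋ] [InnerProductSpace ℂ ℋ]
    [CompleteSpace ℋ] (R : ℋ →L[ℂ] ℋ) (hR : 0 ≤ R) (x : ℋ) (hx : inner ℂ x (R x) = 0) :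
    R x = 0 := by
  have hS : (CFC.sqrt R).IsPositive := (nonneg_iff_isPositive _).1 (CFC.sqrt_nonneg R)
  have hSS : CFC.sqrt R (CFC.sqrt R x) = R x :=
    congrArg (fun A : ℋ →L[ℂ] ℋ => A x) (CFC.sqrt_mul_sqrt_self R hR)
  have h : inner ℂ (CFC.sqrt R x) (CFC.sqrt R x) = 0 := by
    rw [← hx, ← hSS]
    exact hS.isSymmetric x (CFC.sqrt R x)
  rw [← hSS, inner_self_eq_zero.1 h, map_zero]

theorem aux_nonneg {ℋ : Type*} [NormedAddCommGroup ℋ] [InnerProductSpace ℂ ℋ]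
    [CompleteSpace ℋ] (T : ℕ → ℋ →L[ℂ] ℋ) (hT : ∀ n, 1 ≤ n → 0 ≤ T n ∧ T n ≤ 1) (n : ℕ) :
    0 ≤ shortR T n := by
  cases n with
  | zero => exact zero_le_one
  | succ n =>
    have hs : IsSelfAdjoint (CFC.sqrt (shortR T n)) := IsSelfAdjoint.of_nonneg (CFC.sqrt_nonneg _)
    have := star_left_conjugate_nonneg (sub_nonneg.2 (hT (n+1) (by omega)).2)
      (CFC.sqrt (shortR T n))
    rwa [hs.star_eq] at this

/-- If the effects are supported in the closed subspace `U` and the shorting dynamic exhausts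
`U` (i.e. `⟨x, R n x⟩ → 0` for every `x ∈ U`), then the strong limit `R∞` of the iterates is
the orthogonal projection onto `Uᗮ`. -/
theorem shorting_limit_eq_proj {ℋ : Type*} [NormedAddCommGroup ℋ]
    [InnerProductSpace ℂ ℋ] [CompleteSpace ℋ]
    (U : Submodule ℂ ℋ) [CompleteSpace U]
    (T : ℕ → ℋ →L[ℂ] ℋ) (hT : ∀ n, 1 ≤ n → 0 ≤ T n ∧ T n ≤ 1)
    (hTU : ∀ n, 1 ≤ n → T n = projCLM U ∘L (T n ∘L projCLM U))
    (hexh : ∀ x ∈ U, Tendsto (fun n => (inner ℂ x (shortR T n x) : ℂ)) atTop (𝓝 0))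
    (Rinf : ℋ →L[ℂ] ℋ)
    (hRinf : ∀ x : ℋ, Tendsto (fun n => shortR T n x) atTop (𝓝 (Rinf x))) :
    Rinf = projCLM Uᗮ := by
  have hfix : ∀ x ∈ Uᗮ, ∀ n, shortR T n x = x := by
    intro x hx n
    induction n with
    | zero => rfl
    | succ n ih =>
      have h1 := aux_sqrt_fix _ (aux_nonneg T hT n) x ih
      have h2 : T (n+1) x = 0 := by
        rw [hTU (n+1) (by omega)]
        have h3 : projCLM U x = 0 := by
          exact congrArg Subtype.val (Submodule.orthogonalProjectionOnto_eq_zero_iff.2 hx)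
        simp [h3]
      simp [shortR, h1, h2]
  have hpos : 0 ≤ Rinf := by
    rw [nonneg_iff_isPositive, isPositive_iff_complex]
    intro x
    have h : (0:ℂ) ≤ inner ℂ (Rinf x) x := by
      refine ge_of_tendsto' ((hRinf x).inner tendsto_const_nhds) fun n => ?_
      exact ((nonneg_iff_isPositive _).1 (aux_nonneg T hT n)).inner_nonneg_left x
    rw [Complex.nonneg_iff] at h
    exact ⟨Complex.ext rfl h.2, h.1⟩
  have hU : ∀ x ∈ U, Rinf x = 0 := fun x hx => aux_zero Rinf hpos x
    (tendsto_nhds_unique (tendsto_const_nhds.inner (hRinf x)) (hexh x hx))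
  have hV : ∀ x ∈ Uᗮ, Rinf x = x := fun x hx =>
    tendsto_nhds_unique (hRinf x) (by simp [hfix x hx])
  ext x
  obtain ⟨u, hu, v, hv, rfl⟩ := U.exists_add_mem_mem_orthogonal x
  have e1 : projCLM Uᗮ u = 0 := by
    have : u ∈ Uᗮᗮ := Submodule.le_orthogonal_orthogonal U hu
    exact congrArg Subtype.val (Submodule.orthogonalProjectionOnto_eq_zero_iff.2 this)
  have e2 : projCLM Uᗮ v = v := by
    exact Submodule.starProjection_eq_self_iff.2 hv
  rw [map_add, map_add, hU u hu, hV v hv, e1, e2]
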